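/- For k ≥ 1, let T be a feasible connected digraph of order k, and suppose n·rₙ² → λ for some λ ∈ (0,∞) as n → ∞. Then n⁻¹·E[H̃_{n,T}] → k⁻¹ ∫_{ℝ²} φ_T(λ f(x)) f(x) dx as n → ∞. -/

import Mathlib

open MeasureTheory ProbabilityTheory Filter Real Set
open scoped Topology

noncomputable section

/-- The circular sector with apex `x`, radius `r`, central angle `a` and
inclination `y` (measured anticlockwise from the horizontal direction). -/
def sector (a : ℝ) (x : ℂ) (y r : ℝ) : Set ℂ :=
  {z : ℂ | ‖z - x‖ ≤ r ∧
    ∃ t : ℝ, y ≤ t ∧ t ≤ y + a ∧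
      z - x = (‖z - x‖ : ℂ) * Complex.exp (t * Complex.I)}

/-- Arc relation of the sector digraph on the configuration `x` (points) and `y`
(inclinations) with cutoff `r`: there is an arc from `i` to `j` iff `i ≠ j` and
the point `x j` lies in the sector of `i`. -/
def arc (a r : ℝ) {n : ℕ} (x : Fin n → ℂ) (y : Fin n → ℝ) (i j : Fin n) : Prop :=
  i ≠ j ∧ x j ∈ sector a (x i) (y i) r

/-- The sector digraph (cutoff `r`) on the `k`-point configuration `(x, y)` is
isomorphic to the digraph `T` on `Fin k`. -/
def isoT (a r : ℝ) {k : ℕ} (T : Fin k → Fin k → Prop) (x : Fin k → ℂ) (y : Fin k → ℝ) : Prop :=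
  ∃ e : Equiv.Perm (Fin k), ∀ i j, T i j ↔ arc a r x y (e i) (e j)

/-- The number of induced subdigraphs of the sector digraph on the configuration
`(x, y)` with cutoff `r` that are isomorphic to `T`. -/
def inducedCount (a r : ℝ) {k : ℕ} (T : Fin k → Fin k → Prop) {n : ℕ}
    (x : Fin n → ℂ) (y : Fin n → ℝ) : ℕ :=
  Set.ncard {s : Finset (Fin n) |
    ∃ g : Fin k ↪ Fin n, Finset.univ.map g = s ∧
      ∀ i j, T i j ↔ arc a r x y (g i) (g j)}

/-- The number of isolated induced subdigraphs of the sector digraph on the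
configuration `(x, y)` with cutoff `r` that are isomorphic to `T`: `k`-element
vertex subsets inducing a digraph isomorphic to `T` with no arc leaving the subset. -/
def isolatedCount (a r : ℝ) {k : ℕ} (T : Fin k → Fin k → Prop) {n : ℕ}
    (x : Fin n → ℂ) (y : Fin n → ℝ) : ℕ :=
  Set.ncard {s : Finset (Fin n) |
    (∃ g : Fin k ↪ Fin n, Finset.univ.map g = s ∧
      ∀ i j, T i j ↔ arc a r x y (g i) (g j)) ∧
    ∀ i ∈ s, ∀ j, j ∉ s → ¬ arc a r x y i j}

open Classical in
/-- The indicator function `h_T`: equal to `1` if the sector digraph with radius `1`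
on the configuration `(x, y)` is isomorphic to `T`, and `0` otherwise. -/
def hInd (a : ℝ) {k : ℕ} (T : Fin k → Fin k → Prop) (x : Fin k → ℂ) (y : Fin k → ℝ) : ℝ :=
  if isoT a 1 T x y then 1 else 0

/-- The `k`-point configuration `(0, z 1, …, z (k-1))`. -/
def pts {k : ℕ} (z : Fin (k - 1) → ℂ) (i : Fin k) : ℂ :=
  if h : (i : ℕ) = 0 then 0 else z ⟨(i : ℕ) - 1, by have := i.isLt; omega⟩

/-- The Lebesgue measure of `S(x₁,…,x_k,y₁,…,y_k) = ∪_{i=1}^k S(xᵢ,yᵢ,1)`. -/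
def sectorUnionVol (a : ℝ) {k : ℕ} (x : Fin k → ℂ) (y : Fin k → ℝ) : ℝ :=
  (volume (⋃ i, sector a (x i) (y i) 1)).toReal

/-- The function `φ_T`. -/
def phiT (a : ℝ) (k : ℕ) (T : Fin k → Fin k → Prop) (t : ℝ) : ℝ :=
  if k = 1 then Real.exp (-(t * a) / 2)
  else (t ^ (k - 1) / ((k - 1).factorial * (2 * π) ^ k)) *
    ∫ y in Set.univ.pi (fun _ : Fin k => Set.Ico 0 (2 * π)),
      ∫ z : Fin (k - 1) → ℂ,
        hInd a T (pts z) y * Real.exp (-t * sectorUnionVol a (pts z) y)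

/-- The constant `μ_T`. -/
def muT (a : ℝ) (k : ℕ) (T : Fin k → Fin k → Prop) (f : ℂ → ℝ) : ℝ :=
  (1 / (k.factorial * (2 * π) ^ k)) *
    ∫ y in Set.univ.pi (fun _ : Fin k => Set.Ico 0 (2 * π)),
      ∫ z : Fin (k - 1) → ℂ, ∫ x : ℂ, hInd a T (pts z) y * f x ^ k


lemma sector_isClosed (a r : ℝ) :
    IsClosed {q : (ℂ × ℝ) × ℂ | q.2 ∈ sector a q.1.1 q.1.2 r} := by
  have h1 : IsClosed {q : (ℂ × ℝ) × ℂ | ‖q.2 - q.1.1‖ ≤ r} :=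
    isClosed_le (by fun_prop) (by fun_prop)
  have h2 : IsClosed {p : (Icc (0:ℝ) a) × ((ℂ × ℝ) × ℂ) |
      p.2.2 - p.2.1.1 = (‖p.2.2 - p.2.1.1‖ : ℂ) *
        Complex.exp (((p.2.1.2 + (p.1 : ℝ) : ℝ) : ℂ) * Complex.I)} :=
    isClosed_eq (by fun_prop) (by fun_prop)
  have h3 := isClosedMap_snd_of_compactSpace _ h2
  convert! h1.inter h3 using 1
  ext q
  simp only [sector, mem_ofPred_eq, mem_inter_iff, mem_image, Prod.exists, Subtype.exists]
  refine and_congr_right fun _ => ?_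
  constructor
  · rintro ⟨t, ht1, ht2, h⟩
    refine ⟨t - q.1.2, ⟨by linarith, by linarith⟩, q.1.1, q.1.2, q.2, ?_, rfl⟩
    rw [show q.1.2 + (t - q.1.2) = t by ring]
    exact h
  · rintro ⟨t, ⟨ht1, ht2⟩, b, b', c, h, rfl⟩
    exact ⟨b' + t, by linarith, by dsimp; linarith, h⟩

lemma sector_measurableSet (a r : ℝ) (x : ℂ) (y : ℝ) : MeasurableSet (sector a x y r) := by
  have := (sector_isClosed a r).measurableSet
  exact (measurable_prodMk_left (x := (x, y))) this

lemma sector_scale (a r : ℝ) (hr : 0 < r) (c u v : ℂ) (y : ℝ) :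
    c + r * u ∈ sector a (c + r * v) y r ↔ u ∈ sector a v y 1 := by
  have hn : ‖c + r * u - (c + r * v)‖ = r * ‖u - v‖ := by
    rw [show c + r * u - (c + r * v) = r * (u - v) by ring, norm_mul]
    simp [abs_of_pos hr]
  have hr' : (r : ℂ) ≠ 0 := by exact_mod_cast hr.ne'
  simp only [sector, mem_ofPred_eq, hn]
  refine and_congr ?_ (exists_congr fun t => and_congr_right fun _ => and_congr_right fun _ => ?_)
  · constructor
    · intro h; by_contra! h'; nlinarith
    · intro h; nlinarith
  · rw [show c + r * u - (c + r * v) = r * (u - v) by ring]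
    push_cast
    rw [mul_assoc]
    exact mul_right_inj' hr'

lemma sector_subset_closedBall (a r : ℝ) (x : ℂ) (y : ℝ) :
    sector a x y r ⊆ Metric.closedBall x r := by
  intro z hz
  rw [Metric.mem_closedBall, dist_eq_norm]
  exact hz.1

lemma sector_volume_symm (a : ℝ) (ha : 0 < a) (ha' : a ≤ 2 * π) :
    volume (sector a 0 (-(a/2)) 1) = ENNReal.ofReal (a / 2) := by
  rw [← lintegral_indicator_one (sector_measurableSet a 1 0 (-(a/2))),
    ← Complex.lintegral_comp_polarCoord_symm]
  have : ∀ p ∈ polarCoord.target,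
      ENNReal.ofReal p.1 • (sector a 0 (-(a/2)) 1).indicator (1 : ℂ → ENNReal)
        (Complex.polarCoord.symm p) =
      ((Ioc (0:ℝ) 1).indicator (fun x => ENNReal.ofReal x) p.1) *
       ((Ioo (-π) π ∩ Icc (-(a/2)) (a/2)).indicator 1 p.2) := by
    rintro ⟨ρ, θ⟩ hp
    simp only [polarCoord_target, mem_prod, mem_Ioi] at hp
    obtain ⟨h1, h2⟩ := hp
    have key : Complex.polarCoord.symm (ρ, θ) ∈ sector a 0 (-(a/2)) 1 ↔
        ρ ≤ 1 ∧ θ ∈ Icc (-(a/2)) (a/2) := by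
      have e1 : Complex.polarCoord.symm (ρ, θ) = ρ * Complex.exp (θ * Complex.I) := by
        rw [Complex.polarCoord_symm_apply, Complex.exp_mul_I]
        push_cast; rfl
      have e2 : ‖(ρ * Complex.exp (θ * Complex.I) : ℂ)‖ = ρ := by
        rw [norm_mul, Complex.norm_exp_ofReal_mul_I]; simp [abs_of_pos h1]
      have h1' : (ρ : ℂ) ≠ 0 := by exact_mod_cast h1.ne'
      simp only [sector, mem_ofPred_eq, e1, sub_zero, e2]
      refine and_congr_right fun _ => ?_
      constructor
      · rintro ⟨t, ht1, ht2, h⟩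
        have h := mul_left_cancel₀ h1' h
        rw [Complex.exp_eq_exp_iff_exists_int] at h
        obtain ⟨n, hn⟩ := h
        have hn' : θ = t + n * (2 * π) := by
          have : (θ : ℂ) * Complex.I = ((t + n * (2 * π) : ℝ) : ℂ) * Complex.I := by
            rw [hn]; push_cast; ring
          exact_mod_cast mul_right_cancel₀ Complex.I_ne_zero this
        have hpi := Real.pi_pos
        obtain ⟨h21, h22⟩ := h2
        have n1 : (n : ℝ) < 1 := by by_contra! hh; nlinarith
        have n2 : (-1 : ℝ) < n := by by_contra! hh; nlinarith
        have n0 : n = 0 := by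
          have n1' : n < 1 := by exact_mod_cast n1
          have n2' : -1 < n := by exact_mod_cast n2
          omega
        subst n0
        simp at hn'
        subst hn'
        exact ⟨ht1, by linarith⟩
      · rintro ⟨h3, h4⟩
        exact ⟨θ, h3, by linarith, rfl⟩
    classical
    by_cases hρ : ρ ≤ 1 <;> by_cases hθ : θ ∈ Icc (-(a/2)) (a/2) <;>
      simp only [indicator_apply, key, hρ, hθ, h1, h2, mem_inter_iff, mem_Ioc] <;> simp
  rw [setLIntegral_congr_fun polarCoord.open_target.measurableSet this, polarCoord_target,
    Measure.volume_eq_prod, ← Measure.prod_restrict,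
    lintegral_prod_mul (by fun_prop (disch := measurability)) (by fun_prop (disch := measurability))]
  have i1 : ∫⁻ x in Ioi (0:ℝ), (Ioc (0:ℝ) 1).indicator (fun x => ENNReal.ofReal x) x
      = ENNReal.ofReal (1/2) := by
    rw [lintegral_indicator measurableSet_Ioc, Measure.restrict_restrict measurableSet_Ioc,
      inter_eq_left.mpr Ioc_subset_Ioi_self, ← ofReal_integral_eq_lintegral_ofReal]
    · rw [← intervalIntegral.integral_of_le zero_le_one]; simp
    · exact (continuous_id.integrableOn_Ioc)
    · filter_upwards [ae_restrict_mem measurableSet_Ioc] with x hx using hx.1.le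
  have i2 : ∫⁻ y in Ioo (-π) π, (Ioo (-π) π ∩ Icc (-(a/2)) (a/2)).indicator 1 y
      = ENNReal.ofReal a := by
    rw [lintegral_indicator_one (by measurability), Measure.restrict_apply (by measurability)]
    rw [inter_eq_left.mpr inter_subset_left]
    apply le_antisymm
    · calc _ ≤ volume (Icc (-(a/2)) (a/2)) := measure_mono inter_subset_right
        _ = _ := by rw [Real.volume_Icc]; congr 1; ring
    · calc _ = volume (Ioo (-(a/2)) (a/2)) := by rw [Real.volume_Ioo]; congr 1; ring
        _ ≤ _ := measure_mono (subset_inter (Ioo_subset_Ioo (by linarith) (by linarith))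
            Ioo_subset_Icc_self)
  rw [i1, i2, ← ENNReal.ofReal_mul (by norm_num)]
  congr 1; ring

lemma sector_volume (a : ℝ) (ha : 0 < a) (ha' : a ≤ 2 * π) (y : ℝ) :
    volume (sector a 0 y 1) = ENNReal.ofReal (a / 2) := by
  rw [← sector_volume_symm a ha ha']
  let R := rotation (Circle.exp (-(a/2) - y))
  have hR : MeasurePreserving R volume volume := R.measurePreserving
  rw [← hR.measure_preimage (sector_measurableSet a 1 0 (-(a/2))).nullMeasurableSet]
  congr 1
  ext z
  simp only [sector, mem_ofPred_eq, mem_preimage, sub_zero, LinearIsometryEquiv.norm_map]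
  refine and_congr_right fun _ => ?_
  have hz : R z = Complex.exp ((-(a/2) - y : ℝ) * Complex.I) * z := by
    rw [show R z = (Circle.exp (-(a/2) - y) : ℂ) * z from rotation_apply _ _, Circle.coe_exp]
  have h0 := Complex.exp_ne_zero ((-(a/2) - y : ℝ) * Complex.I)
  constructor
  · rintro ⟨t, h1, h2, h⟩
    refine ⟨t + (-(a/2) - y), by linarith, by linarith, ?_⟩
    rw [hz]
    nth_rewrite 1 [h]
    rw [mul_left_comm, ← Complex.exp_add]
    congr 2; push_cast; ring
  · rintro ⟨t, h1, h2, h⟩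
    refine ⟨t - (-(a/2) - y), by linarith, by linarith, ?_⟩
    rw [hz] at h
    apply mul_left_cancel₀ h0
    rw [h, mul_left_comm, ← Complex.exp_add]
    congr 2; push_cast; ring

/-- The law of a single point. -/
def muF (f : ℂ → ℝ) : Measure ℂ := volume.withDensity fun x => ENNReal.ofReal (f x)

/-- The law of a single inclination. -/
def nuU : Measure ℝ := (ENNReal.ofReal (2 * π))⁻¹ • volume.restrict (Set.Ico 0 (2 * π))

instance nuU_prob : IsProbabilityMeasure nuU := by
  constructor
  simp only [nuU, Measure.smul_apply, Measure.restrict_apply MeasurableSet.univ, univ_inter,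
    Real.volume_Ico, sub_zero, smul_eq_mul]
  exact ENNReal.inv_mul_cancel (by simp [Real.pi_pos]) ENNReal.ofReal_ne_top

lemma pi_nuU (k : ℕ) : Measure.pi (fun _ : Fin k => nuU) =
    ((ENNReal.ofReal (2 * π))⁻¹ ^ k) •
      (volume.restrict (Set.univ.pi (fun _ : Fin k => Set.Ico 0 (2 * π)))) := by
  rw [volume_pi, Measure.restrict_pi_pi]
  refine Measure.pi_eq fun s _ => ?_
  simp only [Measure.smul_apply, Measure.pi_pi, nuU, smul_eq_mul, Finset.prod_mul_distrib]
  simp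

lemma integral_pi_nuU (k : ℕ) (g : (Fin k → ℝ) → ℝ) :
    ∫ y, g y ∂(Measure.pi (fun _ : Fin k => nuU)) =
      ((2 * π) ^ k)⁻¹ * ∫ y in Set.univ.pi (fun _ : Fin k => Set.Ico 0 (2 * π)), g y := by
  rw [pi_nuU, integral_smul_measure, smul_eq_mul]
  congr 1
  rw [ENNReal.toReal_pow, ENNReal.toReal_inv, ENNReal.toReal_ofReal (by positivity), inv_pow]

lemma aemeas_of_continuousAt (f : ℂ → ℝ) (hfc : ∀ᵐ x : ℂ, ContinuousAt f x) :
    AEMeasurable f volume := by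
  have hm : MeasurableSet {x | ContinuousAt f x} := (IsGδ.setOfPred_continuousAt f).measurableSet
  have hr : volume.restrict {x | ContinuousAt f x} = (volume : Measure ℂ) :=
    Measure.restrict_eq_self_of_ae_mem hfc
  rw [← hr]
  exact ContinuousOn.aemeasurable (fun x hx => ContinuousAt.continuousWithinAt hx) hm

lemma pi_muF (f : ℂ → ℝ) (hf0 : ∀ x, 0 ≤ f x) (hfi : Integrable f) (m : ℕ)
    [SigmaFinite (muF f)] :
    Measure.pi (fun _ : Fin m => muF f) =
      (volume : Measure (Fin m → ℂ)).withDensity (fun x => ENNReal.ofReal (∏ i, f (x i))) := by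
  refine Measure.pi_eq fun s hs => ?_
  rw [withDensity_apply _ (MeasurableSet.univ_pi hs), volume_pi, Measure.restrict_pi_pi,
    ← ofReal_integral_eq_lintegral_ofReal, integral_fintype_prod_eq_prod (fun _ => f),
    ENNReal.ofReal_prod_of_nonneg]
  · refine Finset.prod_congr rfl fun i _ => ?_
    rw [muF, withDensity_apply _ (hs i), ofReal_integral_eq_lintegral_ofReal hfi.integrableOn]
    exact Eventually.of_forall hf0
  · exact fun i _ => integral_nonneg hf0
  · exact Integrable.fintype_prod (f := fun _ => f) fun i => hfi.integrableOn
  · exact Eventually.of_forall fun x => Finset.prod_nonneg fun i _ => hf0 _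

lemma aemeas_prod (f : ℂ → ℝ) (hf : AEMeasurable f volume) (m : ℕ) :
    AEMeasurable (fun x : Fin m → ℂ => ∏ i, f (x i)) volume := by
  refine Finset.aemeasurable_fun_prod _ fun i _ => ?_
  exact hf.comp_quasiMeasurePreserving
    (Measure.quasiMeasurePreserving_eval (fun _ : Fin m => (volume : Measure ℂ)) i)

lemma integral_pi_muF (f : ℂ → ℝ) (hf0 : ∀ x, 0 ≤ f x) (hfi : Integrable f) (m : ℕ)
    [SigmaFinite (muF f)] (g : (Fin m → ℂ) → ℝ) :
    ∫ x, g x ∂(Measure.pi (fun _ : Fin m => muF f)) = ∫ x, (∏ i, f (x i)) * g x := by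
  rw [pi_muF f hf0 hfi, integral_withDensity_eq_integral_toReal_smul₀]
  · refine integral_congr_ae (Eventually.of_forall fun x => ?_)
    simp only [smul_eq_mul]
    rw [ENNReal.toReal_ofReal (Finset.prod_nonneg fun i _ => hf0 _)]
  · exact (aemeas_prod f hfi.aemeasurable m).ennreal_ofReal
  · simp

lemma integral_muF (f : ℂ → ℝ) (hf0 : ∀ x, 0 ≤ f x) (hfi : AEMeasurable f) (g : ℂ → ℝ) :
    ∫ x, g x ∂(muF f) = ∫ x, g x * f x := by
  rw [muF, integral_withDensity_eq_integral_toReal_smul₀ hfi.ennreal_ofReal (by simp)]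
  refine integral_congr_ae (Eventually.of_forall fun x => ?_)
  simp only [smul_eq_mul]
  rw [ENNReal.toReal_ofReal (hf0 _), mul_comm]

open Classical in
/-- The conditional probability that a `k`-tuple forms an isolated copy of `T`. -/
def Gfun (a r : ℝ) {k : ℕ} (T : Fin k → Fin k → Prop) (μ : Measure ℂ) (l : ℕ)
    (q : (Fin k → ℂ) × (Fin k → ℝ)) : ℝ :=
  (if isoT a r T q.1 q.2 then 1 else 0) * (μ.real (⋃ i, sector a (q.1 i) (q.2 i) r)ᶜ) ^ l

lemma ms_and {α : Type*} [MeasurableSpace α] {p q : α → Prop} (hp : MeasurableSet {a | p a})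
    (hq : MeasurableSet {a | q a}) : MeasurableSet {a | p a ∧ q a} := hp.inter hq

lemma ms_exists {α ι : Type*} [MeasurableSpace α] [Countable ι] {p : ι → α → Prop}
    (hp : ∀ i, MeasurableSet {a | p i a}) : MeasurableSet {a | ∃ i, p i a} := by
  rw [measurableSet_setOfPred]
  exact Measurable.exists fun i => measurableSet_setOfPred.1 (hp i)

lemma ms_forall {α ι : Type*} [MeasurableSpace α] [Countable ι] {p : ι → α → Prop}
    (hp : ∀ i, MeasurableSet {a | p i a}) : MeasurableSet {a | ∀ i, p i a} := by
  rw [measurableSet_setOfPred]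
  exact Measurable.forall fun i => measurableSet_setOfPred.1 (hp i)

lemma meas_mem_sector {α : Type*} [MeasurableSpace α] (a r : ℝ) {u v : α → ℂ} {w : α → ℝ}
    (hu : Measurable u) (hv : Measurable v) (hw : Measurable w) :
    MeasurableSet {q | u q ∈ sector a (v q) (w q) r} := by
  have : Measurable fun q => ((v q, w q), u q) := (hv.prodMk hw).prodMk hu
  exact this (sector_isClosed a r).measurableSet

lemma meas_isoT (a r : ℝ) {k : ℕ} (T : Fin k → Fin k → Prop) :
    MeasurableSet {q : (Fin k → ℂ) × (Fin k → ℝ) | isoT a r T q.1 q.2} := by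
  simp only [isoT, arc]
  refine ms_exists fun e => ms_forall fun i =>
    ms_forall fun j => ?_
  refine MeasurableSet.iff (MeasurableSet.const _) ?_
  refine ms_and (MeasurableSet.const _) ?_
  exact meas_mem_sector a r (by fun_prop) (by fun_prop) (by fun_prop)

lemma Gfun_measurable (a r : ℝ) {k : ℕ} (T : Fin k → Fin k → Prop) (μ : Measure ℂ)
    [IsFiniteMeasure μ] (l : ℕ) : Measurable (Gfun a r T μ l) := by
  classical
  refine Measurable.mul ?_ ?_
  · exact Measurable.ite (meas_isoT a r T) measurable_const measurable_const
  · refine Measurable.pow_const ?_ _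
    have : MeasurableSet {q : ((Fin k → ℂ) × (Fin k → ℝ)) × ℂ |
        q.2 ∈ (⋃ i, sector a (q.1.1 i) (q.1.2 i) r)ᶜ} := by
      simp only [mem_compl_iff, mem_iUnion]
      refine MeasurableSet.compl (s := {q : ((Fin k → ℂ) × (Fin k → ℝ)) × ℂ |
        ∃ i, q.2 ∈ sector a (q.1.1 i) (q.1.2 i) r}) ?_
      refine ms_exists fun i => ?_
      exact meas_mem_sector a r (by fun_prop) (by fun_prop) (by fun_prop)
    exact (measurable_measure_prodMk_left this).ennreal_toReal

lemma Gfun_nonneg (a r : ℝ) {k : ℕ} (T : Fin k → Fin k → Prop) (μ : Measure ℂ)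
    (l : ℕ) (q) : 0 ≤ Gfun a r T μ l q := by
  unfold Gfun
  split_ifs <;> positivity

lemma Gfun_le_one (a r : ℝ) {k : ℕ} (T : Fin k → Fin k → Prop) (μ : Measure ℂ)
    [IsProbabilityMeasure μ] (l : ℕ) (q) : Gfun a r T μ l q ≤ 1 := by
  unfold Gfun
  have : (μ.real (⋃ i, sector a (q.1 i) (q.2 i) r)ᶜ) ^ l ≤ 1 :=
    pow_le_one₀ measureReal_nonneg measureReal_le_one
  split_ifs
  · simpa using this
  · simp

/-- The event that `s` spans an isolated copy of `T`. -/
def goodSet (a r : ℝ) {k : ℕ} (T : Fin k → Fin k → Prop) {n : ℕ} (s : Finset (Fin n)) :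
    Set (Fin n → ℂ × ℝ) :=
  {w | (∃ g : Fin k ↪ Fin n, Finset.univ.map g = s ∧
      ∀ i j, T i j ↔ arc a r (fun i => (w i).1) (fun i => (w i).2) (g i) (g j)) ∧
    ∀ i ∈ s, ∀ j, j ∉ s → ¬ arc a r (fun i => (w i).1) (fun i => (w i).2) i j}

lemma goodSet_measurable (a r : ℝ) {k : ℕ} (T : Fin k → Fin k → Prop) {n : ℕ}
    (s : Finset (Fin n)) : MeasurableSet (goodSet a r T s) := by
  have harc : ∀ i j : Fin n, MeasurableSet {w : Fin n → ℂ × ℝ |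
      arc a r (fun i => (w i).1) (fun i => (w i).2) i j} := by
    intro i j
    simp only [arc]
    refine ms_and (MeasurableSet.const _) ?_
    exact meas_mem_sector a r (by fun_prop) (by fun_prop) (by fun_prop)
  unfold goodSet
  refine ms_and ?_ ?_
  · refine ms_exists fun g => ms_and (MeasurableSet.const _) ?_
    refine ms_forall fun i => ms_forall fun j => ?_
    exact MeasurableSet.iff (MeasurableSet.const _) (harc _ _)
  · refine ms_forall fun i => MeasurableSet.imp (MeasurableSet.const _) <|
      ms_forall fun j => MeasurableSet.imp (MeasurableSet.const _) ?_
    exact (harc i j).compl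

lemma isolatedCount_eq (a r : ℝ) {k : ℕ} (T : Fin k → Fin k → Prop) {n : ℕ}
    (w : Fin n → ℂ × ℝ) :
    (isolatedCount a r T (fun i => (w i).1) (fun i => (w i).2) : ℝ) =
      ∑ s ∈ Finset.powersetCard k (Finset.univ : Finset (Fin n)),
        (goodSet a r T s).indicator (fun _ => (1 : ℝ)) w := by
  classical
  unfold isolatedCount
  have : {s : Finset (Fin n) |
    (∃ g : Fin k ↪ Fin n, Finset.univ.map g = s ∧
      ∀ i j, T i j ↔ arc a r (fun i => (w i).1) (fun i => (w i).2) (g i) (g j)) ∧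
    ∀ i ∈ s, ∀ j, j ∉ s → ¬ arc a r (fun i => (w i).1) (fun i => (w i).2) i j} =
    (((Finset.powersetCard k (Finset.univ : Finset (Fin n))).filter
      (fun s => w ∈ goodSet a r T s) : Finset (Finset (Fin n))) : Set (Finset (Fin n))) := by
    ext s
    rw [Finset.mem_coe, Finset.mem_filter, Finset.mem_powersetCard]
    simp only [Finset.subset_univ, true_and]
    constructor
    · rintro h
      refine ⟨?_, h⟩
      obtain ⟨⟨g, hg, -⟩, -⟩ := h
      rw [← hg]; simp
    · exact fun h => h.2
  rw [this, Set.ncard_coe_finset, Finset.card_filter]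
  push_cast
  refine Finset.sum_congr rfl fun s _ => ?_
  simp [indicator_apply]

lemma pi_all (p : Measure (ℂ × ℝ)) [IsProbabilityMeasure p] (l : ℕ) (B : Set (ℂ × ℝ)) :
    (Measure.pi (fun _ : Fin l => p)) {v | ∀ j, v j ∈ B} = p B ^ l := by
  have : {v : Fin l → ℂ × ℝ | ∀ j, v j ∈ B} = univ.pi fun _ => B := by
    ext v; simp
  rw [this, Measure.pi_pi]; simp

lemma goodSet_iff (a r : ℝ) {k l : ℕ} (T : Fin k → Fin k → Prop) {n : ℕ}
    (s : Finset (Fin n)) (e : Fin k ⊕ Fin l ≃ Fin n) (h1 : ∀ i, e (Sum.inl i) ∈ s)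
    (h2 : ∀ i, e (Sum.inr i) ∉ s) (w : Fin n → ℂ × ℝ) :
    w ∈ goodSet a r T s ↔
      isoT a r T (fun i => (w (e (Sum.inl i))).1) (fun i => (w (e (Sum.inl i))).2) ∧
      ∀ j : Fin l, (w (e (Sum.inr j))).1 ∈
        (⋃ i : Fin k, sector a (w (e (Sum.inl i))).1 (w (e (Sum.inl i))).2 r)ᶜ := by
  have hs : ∀ j, j ∈ s ↔ ∃ i, e (Sum.inl i) = j := by
    intro j
    constructor
    · intro hj
      obtain ⟨q, rfl⟩ := e.surjective j
      rcases q with i | i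
      · exact ⟨i, rfl⟩
      · exact absurd hj (h2 i)
    · rintro ⟨i, rfl⟩; exact h1 i
  have hs' : ∀ j, j ∉ s ↔ ∃ i, e (Sum.inr i) = j := by
    intro j
    constructor
    · intro hj
      obtain ⟨q, rfl⟩ := e.surjective j
      rcases q with i | i
      · exact absurd (h1 i) hj
      · exact ⟨i, rfl⟩
    · rintro ⟨i, rfl⟩; exact h2 i
  unfold goodSet isoT
  simp only [mem_ofPred_eq]
  refine and_congr ?_ ?_
  · constructor
    · rintro ⟨g, hg, hgT⟩
      have hgs : ∀ i, ∃ i', e (Sum.inl i') = g i := fun i => by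
        rw [← hs, ← hg]; simp
      choose σ hσ using hgs
      have hinj : Function.Injective σ := by
        intro i j hij
        apply g.injective
        rw [← hσ, ← hσ, hij]
      refine ⟨Equiv.ofBijective σ (Finite.injective_iff_bijective.1 hinj), fun i j => ?_⟩
      rw [hgT i j]
      simp only [arc, Equiv.ofBijective_apply, hσ]
      refine and_congr_left fun _ => ?_
      rw [← hσ i, ← hσ j]
      simp
    · rintro ⟨σ, hσ⟩
      have hinj : Function.Injective (fun i => e (Sum.inl (σ i))) := by
        intro i j hij
        simpa using hij
      refine ⟨⟨fun i => e (Sum.inl (σ i)), hinj⟩, ?_, fun i j => ?_⟩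
      · ext j
        simp only [Finset.mem_map, Finset.mem_univ, true_and, Function.Embedding.coeFn_mk, hs]
        constructor
        · rintro ⟨i, rfl⟩; exact ⟨σ i, rfl⟩
        · rintro ⟨i, rfl⟩; exact ⟨σ.symm i, by simp⟩
      · rw [hσ i j]
        simp [arc]
  · simp only [mem_compl_iff, mem_iUnion, not_exists]
    constructor
    · intro h j i hm
      refine h _ (h1 i) _ (h2 j) ⟨?_, hm⟩
      simp
    · intro h i hi j hj
      obtain ⟨i, rfl⟩ := (hs _).1 hi
      obtain ⟨j, rfl⟩ := (hs' _).1 hj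
      exact fun hh => h j i hh.2

lemma goodSet_prob (a r : ℝ) {k : ℕ} (T : Fin k → Fin k → Prop) {n : ℕ}
    (μ : Measure ℂ) [IsProbabilityMeasure μ] (ν : Measure ℝ) [IsProbabilityMeasure ν]
    (s : Finset (Fin n)) (hs : s.card = k) :
    (Measure.pi (fun _ : Fin n => μ.prod ν)).real (goodSet a r T s) =
      ∫ w, Gfun a r T μ (n - k) (fun i => (w i).1, fun i => (w i).2)
        ∂(Measure.pi (fun _ : Fin k => μ.prod ν)) := by
  classical
  have hc : sᶜ.card = n - k := by rw [Finset.card_compl, hs]; simp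
  set e := finSumEquivOfFinset hs hc with he
  have h1 : ∀ i, e (Sum.inl i) ∈ s := fun i => by
    rw [he, finSumEquivOfFinset_inl]; exact Finset.orderEmbOfFin_mem _ _ _
  have h2 : ∀ i, e (Sum.inr i) ∉ s := fun i => by
    rw [he, finSumEquivOfFinset_inr, ← Finset.mem_compl]; exact Finset.orderEmbOfFin_mem _ _ _
  set p := μ.prod ν with hp
  have m1 := (measurePreserving_piCongrLeft (fun _ : Fin n => p) e)
  have m2 := measurePreserving_sumPiEquivProdPi_symm (fun _ : Fin k ⊕ Fin (n-k) => p)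
  have m3 := m1.comp m2
  have hm := goodSet_measurable a r T s
  have key : ((MeasurableEquiv.piCongrLeft (fun _ : Fin n => ℂ × ℝ) e) ∘
      (MeasurableEquiv.sumPiEquivProdPi (fun _ : Fin k ⊕ Fin (n-k) => ℂ × ℝ)).symm) ⁻¹'
      (goodSet a r T s) =
      {q | isoT a r T (fun i => (q.1 i).1) (fun i => (q.1 i).2) ∧
        ∀ j, q.2 j ∈ Prod.fst ⁻¹' (⋃ i, sector a (q.1 i).1 (q.1 i).2 r)ᶜ} := by
    ext q
    rw [mem_preimage, goodSet_iff a r T s e h1 h2]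
    have e1 : ∀ x, ((MeasurableEquiv.piCongrLeft (fun _ : Fin n => ℂ × ℝ) e) ∘
      (MeasurableEquiv.sumPiEquivProdPi (fun _ : Fin k ⊕ Fin (n-k) => ℂ × ℝ)).symm) q (e x)
        = (Sum.elim q.1 q.2 x) := by
      intro x
      simp only [Function.comp_apply, MeasurableEquiv.coe_piCongrLeft,
        Equiv.piCongrLeft_apply_apply]
      rcases x with x | x <;> rfl
    simp only [e1]
    rfl
  rw [measureReal_def, ← m3.measure_preimage hm.nullMeasurableSet, key]
  have hm' := m3.measurable hm
  rw [key] at hm'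
  rw [Measure.prod_apply hm', ← integral_toReal (measurable_measure_prodMk_left hm').aemeasurable]
  · refine integral_congr_ae (Eventually.of_forall fun w => ?_)
    dsimp only [Gfun]
    by_cases hi : isoT a r T (fun i => (w i).1) (fun i => (w i).2)
    · have : Prod.mk w ⁻¹' {q : (Fin k → ℂ × ℝ) × (Fin (n-k) → ℂ × ℝ) |
          isoT a r T (fun i => (q.1 i).1) (fun i => (q.1 i).2) ∧
          ∀ j, q.2 j ∈ Prod.fst ⁻¹' (⋃ i, sector a (q.1 i).1 (q.1 i).2 r)ᶜ} =
          {v | ∀ j, v j ∈ Prod.fst ⁻¹' (⋃ i, sector a (w i).1 (w i).2 r)ᶜ} := by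
        ext v; simp [hi]
      rw [this, pi_all, if_pos hi, one_mul, ENNReal.toReal_pow, measureReal_def, hp,
        ← Set.prod_univ, Measure.prod_prod, measure_univ, mul_one]
    · have : Prod.mk w ⁻¹' {q : (Fin k → ℂ × ℝ) × (Fin (n-k) → ℂ × ℝ) |
          isoT a r T (fun i => (q.1 i).1) (fun i => (q.1 i).2) ∧
          ∀ j, q.2 j ∈ Prod.fst ⁻¹' (⋃ i, sector a (q.1 i).1 (q.1 i).2 r)ᶜ} = ∅ := by
        ext v; simp [hi]
      rw [this, if_neg hi]; simp
  · exact Eventually.of_forall fun w => measure_lt_top _ _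

lemma expect_count (a r : ℝ) {k : ℕ} (T : Fin k → Fin k → Prop) {n : ℕ}
    (μ : Measure ℂ) [IsProbabilityMeasure μ] (ν : Measure ℝ) [IsProbabilityMeasure ν] :
    ∫ w, (isolatedCount a r T (fun i => (w i).1) (fun i => (w i).2) : ℝ)
        ∂(Measure.pi (fun _ : Fin n => μ.prod ν)) =
      (n.choose k : ℝ) * ∫ w, Gfun a r T μ (n - k) (fun i => (w i).1, fun i => (w i).2)
        ∂(Measure.pi (fun _ : Fin k => μ.prod ν)) := by
  simp_rw [isolatedCount_eq]
  rw [integral_finsetSum]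
  · rw [Finset.sum_congr rfl (g := fun _ => ∫ w, Gfun a r T μ (n - k)
      (fun i => (w i).1, fun i => (w i).2) ∂(Measure.pi (fun _ : Fin k => μ.prod ν)))]
    · simp
    · intro s hs
      rw [← goodSet_prob a r T μ ν s (Finset.mem_powersetCard.1 hs).2,
        integral_indicator_const _ (goodSet_measurable a r T s)]
      simp
  · intro s _
    exact (integrable_const _).indicator (goodSet_measurable a r T s)

lemma integrable_of_unit {α : Type*} [MeasurableSpace α] (P : Measure α) [IsProbabilityMeasure P]
    (g : α → ℝ) (hg : Measurable g) (h0 : ∀ x, 0 ≤ g x) (h1 : ∀ x, g x ≤ 1) : Integrable g P :=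
  Integrable.of_bound hg.aestronglyMeasurable 1 (Eventually.of_forall fun x => by
    rw [Real.norm_of_nonneg (h0 x)]; exact h1 x)

lemma expect_iter {m : ℕ} (μ : Measure ℂ) [IsProbabilityMeasure μ] (ν : Measure ℝ)
    [IsProbabilityMeasure ν] (G : (Fin (m+1) → ℂ) × (Fin (m+1) → ℝ) → ℝ) (hG : Measurable G)
    (h0 : ∀ q, 0 ≤ G q) (h1 : ∀ q, G q ≤ 1) :
    ∫ w, G (fun i => (w i).1, fun i => (w i).2) ∂(Measure.pi (fun _ : Fin (m+1) => μ.prod ν)) =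
      ∫ x, ∫ y, ∫ z, G (Fin.cons x z, y) ∂(Measure.pi (fun _ : Fin m => μ))
        ∂(Measure.pi (fun _ : Fin (m+1) => ν)) ∂μ := by
  have m1 := measurePreserving_arrowProdEquivProdArrow ℂ ℝ (Fin (m+1)) (fun _ => μ) (fun _ => ν)
  have e1 : ∫ w, G (fun i => (w i).1, fun i => (w i).2)
      ∂(Measure.pi (fun _ : Fin (m+1) => μ.prod ν)) =
      ∫ q, G q ∂((Measure.pi (fun _ : Fin (m+1) => μ)).prod (Measure.pi (fun _ => ν))) := by
    rw [← m1.integral_comp']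
    rfl
  rw [e1, integral_prod_symm _ (integrable_of_unit _ _ hG h0 h1)]
  have m2 := (measurePreserving_piFinSuccAbove (fun _ : Fin (m+1) => μ) 0).symm
  have hc : Measurable fun q : ℂ × (Fin m → ℂ) => (Fin.cons q.1 q.2 : Fin (m+1) → ℂ) := by
    refine measurable_pi_lambda _ fun i => ?_
    refine Fin.cases ?_ (fun j => ?_) i
    · simpa using measurable_fst
    · simp only [Fin.cons_succ]; fun_prop
  have e2 : ∀ y, ∫ x, G (x, y) ∂(Measure.pi (fun _ : Fin (m+1) => μ)) =
      ∫ x, ∫ z, G (Fin.cons x z, y) ∂(Measure.pi (fun _ : Fin m => μ)) ∂μ := by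
    intro y
    rw [← m2.integral_comp', integral_prod]
    · simp [MeasurableEquiv.piFinSuccAbove, Fin.insertNthEquiv]
    · refine integrable_of_unit _ _ ?_ (fun _ => h0 _) (fun _ => h1 _)
      exact (hG.comp (by fun_prop : Measurable fun x : Fin (m+1) → ℂ => (x, y))).comp
        (MeasurableEquiv.measurable _)
  simp_rw [e2]
  rw [integral_integral_swap]
  have hj : Measurable fun q : ((Fin (m+1) → ℝ) × ℂ) × (Fin m → ℂ) =>
      G (Fin.cons q.1.2 q.2, q.1.1) := by
    refine hG.comp (Measurable.prodMk ?_ (by fun_prop))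
    exact hc.comp (by fun_prop : Measurable fun q : ((Fin (m+1) → ℝ) × ℂ) × (Fin m → ℂ) =>
      (q.1.2, q.2))
  refine Integrable.of_bound (C := 1)
    (hj.stronglyMeasurable.integral_prod_right'.aestronglyMeasurable) ?_
  refine Eventually.of_forall fun q => ?_
  refine (norm_integral_le_of_norm_le_const (C := 1) (Eventually.of_forall fun z => ?_)).trans ?_
  · rw [Real.norm_of_nonneg (h0 _)]; exact h1 _
  · simp

lemma isoT_scale (a r : ℝ) (hr : 0 < r) {k : ℕ} (T : Fin k → Fin k → Prop) (c : ℂ)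
    (p : Fin k → ℂ) (y : Fin k → ℝ) :
    isoT a r T (fun i => c + r * p i) y ↔ isoT a 1 T p y := by
  simp only [isoT, arc, sector_scale a r hr]

lemma cons_eq_pts {m : ℕ} (x : ℂ) (r : ℝ) (z : Fin m → ℂ) :
    (Fin.cons x (fun i => x + r * z i) : Fin (m+1) → ℂ) =
      fun i => x + r * pts (k := m+1) z i := by
  funext i
  refine Fin.cases ?_ (fun j => ?_) i
  · simp [pts]
  · simp [pts]

lemma affine_integral {E : Type*} [NormedAddCommGroup E] [NormedSpace ℝ E] [MeasureSpace E]
    [BorelSpace E] [FiniteDimensional ℝ E] [(volume : Measure E).IsAddHaarMeasure]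
    (r : ℝ) (hr : 0 < r) (c : E) (g : E → ℝ) :
    ∫ u, g u = r ^ (Module.finrank ℝ E) * ∫ u, g (c + r • u) := by
  rw [Measure.integral_comp_smul volume (fun u => g (c + u)), integral_add_left_eq_self,
    abs_of_pos (by positivity), smul_eq_mul, ← mul_assoc, mul_inv_cancel₀ (by positivity), one_mul]

lemma affine_qmp (r : ℝ) (hr : 0 < r) (c : ℂ) :
    Measure.QuasiMeasurePreserving (fun u : ℂ => c + r * u) volume volume := by
  refine ⟨by fun_prop, Measure.AbsolutelyContinuous.mk fun s hs h => ?_⟩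
  rw [Measure.map_apply (by fun_prop) hs]
  have : (fun u : ℂ => c + r * u) ⁻¹' s = (fun u : ℂ => r • u) ⁻¹' ((fun u => c + u) ⁻¹' s) := by
    ext u; simp
  rw [this, Measure.addHaar_preimage_smul _ hr.ne', measure_preimage_add, h, mul_zero]

lemma union_measurableSet (a r : ℝ) {k : ℕ} (p : Fin k → ℂ) (y : Fin k → ℝ) :
    MeasurableSet (⋃ i, sector a (p i) (y i) r) :=
  MeasurableSet.iUnion fun _ => sector_measurableSet _ _ _ _

lemma union_finite (a r : ℝ) {k : ℕ} (p : Fin k → ℂ) (y : Fin k → ℝ) :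
    volume (⋃ i, sector a (p i) (y i) r) < ⊤ := by
  refine (measure_iUnion_le _).trans_lt ?_
  rw [tsum_fintype]
  refine ENNReal.sum_lt_top.2 fun i _ => ?_
  exact (measure_mono (sector_subset_closedBall _ _ _ _)).trans_lt measure_closedBall_lt_top

lemma muF_real (f : ℂ → ℝ) (hf0 : ∀ x, 0 ≤ f x) (hfi : Integrable f) (S : Set ℂ)
    (hS : MeasurableSet S) : (muF f).real S = ∫ u in S, f u := by
  rw [measureReal_def, muF, withDensity_apply _ hS, ← ofReal_integral_eq_lintegral_ofReal
    hfi.integrableOn (Eventually.of_forall hf0), ENNReal.toReal_ofReal]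
  exact integral_nonneg hf0

lemma muF_union (f : ℂ → ℝ) (hf0 : ∀ x, 0 ≤ f x) (hfi : Integrable f) (a r : ℝ) (hr : 0 < r)
    {k : ℕ} (c : ℂ) (p : Fin k → ℂ) (y : Fin k → ℝ) :
    (muF f).real (⋃ i, sector a (c + r * p i) (y i) r) =
      r ^ 2 * ∫ u in ⋃ i, sector a (p i) (y i) 1, f (c + r * u) := by
  rw [muF_real f hf0 hfi _ (union_measurableSet _ _ _ _),
    ← integral_indicator (union_measurableSet _ _ _ _),
    ← integral_indicator (union_measurableSet _ _ _ _), affine_integral r hr c,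
    Complex.finrank_real_complex]
  congr 2
  funext u
  classical
  simp only [indicator_apply, mem_iUnion, Complex.real_smul, sector_scale a r hr]

lemma tendsto_union_integral (f : ℂ → ℝ) (hf0 : ∀ x, 0 ≤ f x) (C : ℝ) (hC : ∀ x, f x ≤ C)
    (hfm : AEMeasurable f) (a : ℝ) (r : ℕ → ℝ) (hr : ∀ n, 0 < r n)
    (hr0 : Tendsto r atTop (𝓝 0)) {k : ℕ} (c : ℂ) (hc : ContinuousAt f c)
    (p : Fin k → ℂ) (y : Fin k → ℝ) :
    Tendsto (fun n => ∫ u in ⋃ i, sector a (p i) (y i) 1, f (c + r n * u)) atTop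
      (𝓝 (f c * sectorUnionVol a p y)) := by
  have hlim : f c * sectorUnionVol a p y = ∫ u in ⋃ i, sector a (p i) (y i) 1, f c := by
    rw [setIntegral_const, smul_eq_mul, mul_comm]; rfl
  rw [hlim]
  have hfin := union_finite a 1 p y
  refine tendsto_integral_of_dominated_convergence (fun _ => C) ?_ ?_ ?_ ?_
  · intro n
    exact ((hfm.comp_quasiMeasurePreserving (affine_qmp (r n) (hr n) c)).restrict).aestronglyMeasurable
  · exact integrableOn_const hfin.ne
  · exact fun n => Eventually.of_forall fun u => by
      rw [Real.norm_of_nonneg (hf0 _)]; exact hC _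
  · refine Eventually.of_forall fun u => ?_
    have : Tendsto (fun n => c + (r n : ℂ) * u) atTop (𝓝 c) := by
      have h := ((Complex.continuous_ofReal.tendsto 0).comp hr0).mul_const u
      simpa using h.const_add c
    exact hc.tendsto.comp this

lemma tendsto_pow_sub (s : ℕ → ℝ) (t : ℝ) (k : ℕ)
    (hs : Tendsto (fun n : ℕ => (n : ℝ) * s n) atTop (𝓝 t)) :
    Tendsto (fun n : ℕ => (1 - s n) ^ (n - k)) atTop (𝓝 (Real.exp (-t))) := by
  rw [← tendsto_add_atTop_iff_nat k]
  simp only [Nat.add_sub_cancel]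
  have hs0 : Tendsto s atTop (𝓝 0) := by
    have h := hs.mul tendsto_one_div_atTop_nhds_zero_nat
    rw [mul_zero] at h
    refine h.congr' ?_
    filter_upwards [eventually_gt_atTop 0] with n hn
    field_simp
  have h1 : Tendsto (fun n : ℕ => (n : ℝ) * (-s (n + k))) atTop (𝓝 (-t)) := by
    have h2 := (hs.comp (tendsto_add_atTop_nat k)).sub
      ((hs0.comp (tendsto_add_atTop_nat k)).const_mul (k : ℝ))
    rw [mul_zero, sub_zero] at h2
    refine h2.neg.congr fun n => ?_
    simp only [Function.comp_apply]
    push_cast; ring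
  have := Real.tendsto_one_add_pow_exp_of_tendsto h1
  refine this.congr fun n => ?_
  rw [sub_eq_add_neg]

lemma tendsto_Gfun (f : ℂ → ℝ) (hf0 : ∀ x, 0 ≤ f x) (C : ℝ) (hC : ∀ x, f x ≤ C)
    (hfi : Integrable f) [IsProbabilityMeasure (muF f)] (a : ℝ) (r : ℕ → ℝ) (hr : ∀ n, 0 < r n)
    (hr0 : Tendsto r atTop (𝓝 0)) (L : ℝ)
    (hrL : Tendsto (fun n : ℕ => (n : ℝ) * r n ^ 2) atTop (𝓝 L))
    {k : ℕ} (T : Fin k → Fin k → Prop) (c : ℂ) (hc : ContinuousAt f c)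
    (p : Fin k → ℂ) (y : Fin k → ℝ) :
    Tendsto (fun n => Gfun a (r n) T (muF f) (n - k) (fun i => c + r n * p i, y)) atTop
      (𝓝 (hInd a T p y * Real.exp (-(L * f c) * sectorUnionVol a p y))) := by
  unfold Gfun hInd
  refine Tendsto.mul (tendsto_const_nhds.congr fun n => ?_) ?_
  · by_cases h : isoT a 1 T p y
    · rw [if_pos h, if_pos ((isoT_scale a (r n) (hr n) T c p y).2 h)]
    · rw [if_neg h, if_neg (fun h' => h ((isoT_scale a (r n) (hr n) T c p y).1 h'))]
  rw [show -(L * f c) * sectorUnionVol a p y = -(L * (f c * sectorUnionVol a p y)) by ring]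
  have h1 := tendsto_pow_sub (fun n => (muF f).real (⋃ i, sector a (c + r n * p i) (y i) (r n)))
    (L * (f c * sectorUnionVol a p y)) k ?_
  · refine h1.congr fun n => ?_
    rw [probReal_compl_eq_one_sub (union_measurableSet _ _ _ _)]
  · have := hrL.mul (tendsto_union_integral f hf0 C hC hfi.aemeasurable a r hr hr0 c hc p y)
    refine this.congr fun n => ?_
    rw [muF_union f hf0 hfi a (r n) (hr n)]
    ring

lemma isoT_bound (a : ℝ) {m : ℕ} (T : Fin (m+1) → Fin (m+1) → Prop)
    (hTconn : (SimpleGraph.fromRel T).Connected) (z : Fin m → ℂ) (y : Fin (m+1) → ℝ)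
    (h : isoT a 1 T (pts (k := m+1) z) y) : z ∈ Metric.closedBall (0 : Fin m → ℂ) (m+1) := by
  obtain ⟨e, he⟩ := h
  set P : Fin (m+1) → ℂ := pts (k := m+1) z with hP
  have hT : ∀ i j, T i j → ‖P (e j) - P (e i)‖ ≤ 1 := fun i j hij => ((he i j).1 hij).2.1
  have hadj : ∀ i j, (SimpleGraph.fromRel T).Adj i j → ‖P (e i) - P (e j)‖ ≤ 1 := by
    intro i j hij
    rw [SimpleGraph.fromRel_adj] at hij
    rcases hij.2 with h | h
    · rw [norm_sub_rev]; exact hT _ _ h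
    · exact hT _ _ h
  have hwalk : ∀ i j (w : (SimpleGraph.fromRel T).Walk i j), ‖P (e i) - P (e j)‖ ≤ w.length := by
    intro i j w
    induction w with
    | nil => simp
    | cons h q ih =>
      rename_i u v w
      calc ‖P (e u) - P (e w)‖ ≤ ‖P (e u) - P (e v)‖ + ‖P (e v) - P (e w)‖ :=
            norm_sub_le_norm_sub_add_norm_sub _ _ _
        _ ≤ 1 + q.length := add_le_add (hadj _ _ h) ih
        _ = _ := by rw [SimpleGraph.Walk.length_cons]; push_cast; ring
  rw [mem_closedBall_zero_iff, pi_norm_le_iff_of_nonneg (by positivity)]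
  intro i
  obtain ⟨w, hw⟩ := hTconn.exists_isPath (e.symm i.succ) (e.symm 0)
  have h1 := hwalk _ _ w
  have h2 := hw.length_lt
  simp only [Equiv.apply_symm_apply] at h1
  have e1 : P i.succ = z i := by simp [hP, pts]
  have e2 : P 0 = 0 := by simp [hP, pts]
  rw [e1, e2, sub_zero] at h1
  rw [Fintype.card_fin] at h2
  have : (w.length : ℝ) < m + 1 := by exact_mod_cast h2
  linarith

/-- The rescaled inner integrand. -/
def inner3 (f : ℂ → ℝ) (a : ℝ) (r : ℝ) {m : ℕ} (T : Fin (m+1) → Fin (m+1) → Prop) (n : ℕ)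
    (x : ℂ) (y : Fin (m+1) → ℝ) (z : Fin m → ℂ) : ℝ :=
  (∏ i, f (x + r * z i)) *
    Gfun a r T (muF f) (n - (m+1)) (fun i => x + r * pts (k := m+1) z i, y)

lemma inner_eq (f : ℂ → ℝ) (hf0 : ∀ x, 0 ≤ f x) (hfi : Integrable f)
    [IsProbabilityMeasure (muF f)] (a r : ℝ) (hr : 0 < r) {m : ℕ}
    (T : Fin (m+1) → Fin (m+1) → Prop) (n : ℕ) (x : ℂ) (y : Fin (m+1) → ℝ) :
    ∫ z, Gfun a r T (muF f) (n - (m+1)) (Fin.cons x z, y) ∂(Measure.pi (fun _ : Fin m => muF f)) =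
      r ^ (2 * m) * ∫ z, inner3 f a r T n x y z := by
  rw [integral_pi_muF f hf0 hfi, affine_integral r hr (fun _ : Fin m => x)]
  have : Module.finrank ℝ (Fin m → ℂ) = 2 * m := by
    rw [Module.finrank_pi_fintype]
    simp [Complex.finrank_real_complex, mul_comm]
  rw [this]
  congr 2
  funext z
  unfold inner3
  rw [← cons_eq_pts]
  simp only [Pi.add_apply, Pi.smul_apply, Complex.real_smul]
  rfl

lemma inner3_nonneg (f : ℂ → ℝ) (hf0 : ∀ x, 0 ≤ f x) (a r : ℝ) {m : ℕ}
    (T : Fin (m+1) → Fin (m+1) → Prop) (n : ℕ) (x : ℂ) (y : Fin (m+1) → ℝ) (z) :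
    0 ≤ inner3 f a r T n x y z :=
  mul_nonneg (Finset.prod_nonneg fun _ _ => hf0 _) (Gfun_nonneg _ _ _ _ _ _)

lemma inner3_le (f : ℂ → ℝ) (hf0 : ∀ x, 0 ≤ f x) (C : ℝ) (hC : ∀ x, f x ≤ C)
    [IsProbabilityMeasure (muF f)] (a r : ℝ) (hr : 0 < r) {m : ℕ}
    (T : Fin (m+1) → Fin (m+1) → Prop) (hTconn : (SimpleGraph.fromRel T).Connected)
    (n : ℕ) (x : ℂ) (y : Fin (m+1) → ℝ) (z) :
    inner3 f a r T n x y z ≤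
      (Metric.closedBall (0 : Fin m → ℂ) (m+1)).indicator (fun _ => C ^ m) z := by
  have hp : ∏ i, f (x + r * z i) ≤ C ^ m := by
    calc _ ≤ ∏ i : Fin m, C := Finset.prod_le_prod (fun _ _ => hf0 _) (fun _ _ => hC _)
      _ = _ := by simp
  have hC0 : 0 ≤ C := (hf0 0).trans (hC 0)
  by_cases h : isoT a 1 T (pts (k := m+1) z) y
  · rw [indicator_of_mem (isoT_bound a T hTconn z y h)]
    calc _ ≤ C ^ m * 1 := mul_le_mul hp (Gfun_le_one _ _ _ _ _ _) (Gfun_nonneg _ _ _ _ _ _)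
          (by positivity)
      _ = _ := mul_one _
  · have : inner3 f a r T n x y z = 0 := by
      unfold inner3 Gfun
      simp only [isoT_scale a r hr, h, if_false, zero_mul, mul_zero]
    rw [this]
    exact indicator_nonneg (fun _ _ => by positivity) _

lemma inner_bound (f : ℂ → ℝ) (hf0 : ∀ x, 0 ≤ f x) (C : ℝ) (hC : ∀ x, f x ≤ C)
    [IsProbabilityMeasure (muF f)] (a : ℝ) {m : ℕ}
    (T : Fin (m+1) → Fin (m+1) → Prop) (hTconn : (SimpleGraph.fromRel T).Connected) :
    ∃ M : ℝ, 0 ≤ M ∧ ∀ r, 0 < r → ∀ n x y, ‖∫ z, inner3 f a r T n x y z‖ ≤ M := by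
  have hi : Integrable ((Metric.closedBall (0 : Fin m → ℂ) (m+1)).indicator (fun _ => C ^ m)) :=
    (integrable_indicator_iff Metric.isClosed_closedBall.measurableSet).2
      (integrableOn_const measure_closedBall_lt_top.ne)
  have hb : ∀ r, 0 < r → ∀ n x y, ‖∫ z, inner3 f a r T n x y z‖ ≤
      ∫ z, (Metric.closedBall (0 : Fin m → ℂ) (m+1)).indicator (fun _ => C ^ m) z :=
    fun r hr n x y => norm_integral_le_of_norm_le hi (Eventually.of_forall fun z => by
      rw [Real.norm_of_nonneg (inner3_nonneg f hf0 a r T n x y z)]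
      exact inner3_le f hf0 C hC a r hr T hTconn n x y z)
  exact ⟨_, (norm_nonneg _).trans (hb 1 one_pos 0 0 0), hb⟩

lemma inner_tendsto (f : ℂ → ℝ) (hf0 : ∀ x, 0 ≤ f x) (C : ℝ) (hC : ∀ x, f x ≤ C)
    (hfi : Integrable f) [IsProbabilityMeasure (muF f)] (a : ℝ) (r : ℕ → ℝ) (hr : ∀ n, 0 < r n)
    (hr0 : Tendsto r atTop (𝓝 0)) (L : ℝ)
    (hrL : Tendsto (fun n : ℕ => (n : ℝ) * r n ^ 2) atTop (𝓝 L))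
    {m : ℕ} (T : Fin (m+1) → Fin (m+1) → Prop) (hTconn : (SimpleGraph.fromRel T).Connected)
    (x : ℂ) (hx : ContinuousAt f x) (y : Fin (m+1) → ℝ) :
    Tendsto (fun n => ∫ z, inner3 f a (r n) T n x y z) atTop
      (𝓝 (f x ^ m * ∫ z : Fin m → ℂ, hInd a T (pts (k := m+1) z) y *
        Real.exp (-(L * f x) * sectorUnionVol a (pts (k := m+1) z) y))) := by
  rw [← integral_const_mul]
  refine tendsto_integral_of_dominated_convergence
    ((Metric.closedBall (0 : Fin m → ℂ) (m+1)).indicator (fun _ => C ^ m)) ?_ ?_ ?_ ?_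
  · intro n
    refine AEStronglyMeasurable.mul ?_ ?_
    · exact (aemeas_prod (fun u => f (x + r n * u))
        (hfi.aemeasurable.comp_quasiMeasurePreserving (affine_qmp (r n) (hr n) x)) m
        ).aestronglyMeasurable
    · refine Measurable.aestronglyMeasurable ?_
      refine (Gfun_measurable a (r n) T (muF f) (n - (m+1))).comp
        (Measurable.prodMk ?_ measurable_const)
      refine measurable_pi_lambda _ fun i => ?_
      refine Fin.cases ?_ (fun j => ?_) i
      · simp [pts]
      · simp only [pts, Fin.val_succ, Nat.add_eq_zero_iff, one_ne_zero, and_false, dite_false,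
          Nat.add_sub_cancel]
        fun_prop
  · exact (integrable_indicator_iff Metric.isClosed_closedBall.measurableSet).2
      (integrableOn_const measure_closedBall_lt_top.ne)
  · exact fun n => Eventually.of_forall fun z => by
      rw [Real.norm_of_nonneg (inner3_nonneg f hf0 a _ T n x y z)]
      exact inner3_le f hf0 C hC a _ (hr n) T hTconn n x y z
  · refine Eventually.of_forall fun z => ?_
    refine Tendsto.mul ?_ (tendsto_Gfun f hf0 C hC hfi a r hr hr0 L hrL T x hx _ y)
    have : f x ^ m = ∏ i : Fin m, f x := by simp
    rw [this]
    refine tendsto_finsetProd _ fun i _ => ?_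
    have : Tendsto (fun n => x + (r n : ℂ) * z i) atTop (𝓝 x) := by
      have h := ((Complex.continuous_ofReal.tendsto 0).comp hr0).mul_const (z i)
      simpa using h.const_add x
    exact hx.tendsto.comp this

lemma phiT_eq (a : ℝ) (ha : 0 < a) (ha' : a ≤ 2 * π) (m : ℕ)
    (T : Fin (m+1) → Fin (m+1) → Prop) (hTirr : ∀ i, ¬ T i i) (t : ℝ) :
    phiT a (m+1) T t = (t ^ m / (m.factorial * (2 * π) ^ (m+1))) *
    ∫ y in Set.univ.pi (fun _ : Fin (m+1) => Set.Ico 0 (2 * π)),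
      ∫ z : Fin m → ℂ,
        hInd a T (pts (k := m+1) z) y * Real.exp (-t * sectorUnionVol a (pts (k := m+1) z) y) := by
  unfold phiT
  split_ifs with h
  · obtain rfl : m = 0 := by omega
    have h1 : ∀ (y : Fin 1 → ℝ) (z : Fin 0 → ℂ), hInd a T (pts (k := 0+1) z) y *
        Real.exp (-t * sectorUnionVol a (pts (k := 0+1) z) y) = Real.exp (-(t * a) / 2) := by
      intro y z
      have hi : isoT a 1 T (pts (k := 0+1) z) y := by
        refine ⟨Equiv.refl _, fun i j => ?_⟩
        have : i = j := Fin.ext (by omega)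
        subst this
        simp [hTirr, arc]
      have hv : sectorUnionVol a (pts (k := 0+1) z) y = a / 2 := by
        unfold sectorUnionVol
        have : (⋃ i : Fin (0+1), sector a (pts (k := 0+1) z i) (y i) 1) = sector a 0 (y 0) 1 := by
          refine iUnion_eq_const fun i => ?_
          have : i = 0 := Fin.ext (by have := i.isLt; simp only [Fin.val_zero]; omega)
          subst this
          simp [pts]
        rw [this, sector_volume a ha ha', ENNReal.toReal_ofReal (by positivity)]
      rw [hInd, if_pos hi, one_mul, hv]
      congr 1; ring
    simp_rw [h1]
    have hv : (volume : Measure (Fin 0 → ℂ)).real univ = 1 := by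
      rw [measureReal_def, volume_pi, ← Set.pi_univ univ, Measure.pi_pi]; simp
    have hv2 : (volume : Measure (Fin (0+1) → ℝ)).real
        (Set.univ.pi (fun _ : Fin (0+1) => Set.Ico 0 (2 * π))) = 2 * π := by
      rw [measureReal_def, volume_pi, Measure.pi_pi]
      simp [Real.pi_pos.le]
    rw [setIntegral_const, integral_const, hv, hv2]
    have := Real.pi_pos
    simp only [pow_zero, Nat.factorial_zero, Nat.cast_one, smul_eq_mul]
    field_simp
    simp
  · rfl

lemma outer_tendsto (f : ℂ → ℝ) (hf0 : ∀ x, 0 ≤ f x) (C : ℝ) (hC : ∀ x, f x ≤ C)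
    (hfc : ∀ᵐ x : ℂ, ContinuousAt f x)
    (hfi : Integrable f) [IsProbabilityMeasure (muF f)] (a : ℝ) (r : ℕ → ℝ) (hr : ∀ n, 0 < r n)
    (hr0 : Tendsto r atTop (𝓝 0)) (L : ℝ)
    (hrL : Tendsto (fun n : ℕ => (n : ℝ) * r n ^ 2) atTop (𝓝 L))
    {m : ℕ} (T : Fin (m+1) → Fin (m+1) → Prop) (hTconn : (SimpleGraph.fromRel T).Connected) :
    Tendsto (fun n => ∫ x, ∫ y, (∫ z, inner3 f a (r n) T n x y z)
        ∂(Measure.pi (fun _ : Fin (m+1) => nuU)) ∂(muF f)) atTop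
      (𝓝 (∫ x, ∫ y, (f x ^ m * ∫ z : Fin m → ℂ, hInd a T (pts (k := m+1) z) y *
        Real.exp (-(L * f x) * sectorUnionVol a (pts (k := m+1) z) y))
        ∂(Measure.pi (fun _ : Fin (m+1) => nuU)) ∂(muF f))) := by
  obtain ⟨M, hM0, hM⟩ := inner_bound f hf0 C hC a T hTconn
  have hmeas : ∀ n, StronglyMeasurable fun q : ℂ × (Fin (m+1) → ℝ) =>
      ∫ z, inner3 f a (r n) T n q.1 q.2 z := by
    intro n
    have hG : Measurable fun q : (ℂ × (Fin (m+1) → ℝ)) × (Fin m → ℂ) =>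
        Gfun a (r n) T (muF f) (n - (m+1)) (Fin.cons q.1.1 q.2, q.1.2) := by
      refine (Gfun_measurable a (r n) T (muF f) _).comp (Measurable.prodMk ?_ (by fun_prop))
      refine measurable_pi_lambda _ fun i => ?_
      refine Fin.cases ?_ (fun j => ?_) i
      · simp only [Fin.cons_zero]; fun_prop
      · simp only [Fin.cons_succ]; fun_prop
    have h1 := hG.stronglyMeasurable.integral_prod_right'
      (ν := Measure.pi (fun _ : Fin m => muF f))
    have h2 := h1.const_mul ((r n) ^ (2 * m))⁻¹
    convert! h2 using 1
    funext q
    simp only [inner_eq f hf0 hfi a (r n) (hr n) T n]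
    rw [← mul_assoc, inv_mul_cancel₀ (pow_ne_zero _ (hr n).ne'), one_mul]
  have hac : ∀ᵐ x ∂(muF f), ContinuousAt f x :=
    (withDensity_absolutelyContinuous _ _).ae_le hfc
  refine tendsto_integral_of_dominated_convergence (fun _ => M) ?_ ?_ ?_ ?_
  · intro n
    exact (hmeas n).integral_prod_right'.aestronglyMeasurable
  · exact integrable_const _
  · refine fun n => Eventually.of_forall fun x => ?_
    refine (norm_integral_le_of_norm_le_const (C := M)
      (Eventually.of_forall fun y => hM _ (hr n) n x y)).trans ?_
    simp
  · filter_upwards [hac] with x hx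
    refine tendsto_integral_of_dominated_convergence (fun _ => M) ?_ ?_ ?_ ?_
    · intro n
      exact ((hmeas n).comp_measurable measurable_prodMk_left).aestronglyMeasurable
    · exact integrable_const _
    · exact fun n => Eventually.of_forall fun y => hM _ (hr n) n x y
    · exact Eventually.of_forall fun y =>
        inner_tendsto f hf0 C hC hfi a r hr hr0 L hrL T hTconn x hx y

lemma tendsto_coeff (r : ℕ → ℝ) (L : ℝ) (m : ℕ)
    (hrL : Tendsto (fun n : ℕ => (n : ℝ) * r n ^ 2) atTop (𝓝 L)) :
    Tendsto (fun n : ℕ => (n.choose (m+1) : ℝ) / n * r n ^ (2 * m)) atTop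
      (𝓝 (L ^ m / (m+1).factorial)) := by
  have h1 := isEquivalent_choose (m+1)
  have h2 : Tendsto (fun n : ℕ => (n.choose (m+1) : ℝ) / (n : ℝ) ^ (m+1)) atTop
      (𝓝 (1 / (m+1).factorial)) := by
    have h3 : Asymptotics.IsEquivalent atTop
        (fun n : ℕ => (n.choose (m+1) : ℝ) / (n : ℝ) ^ (m+1))
        (fun n : ℕ => ((n : ℝ) ^ (m+1) / (m+1).factorial) / (n : ℝ) ^ (m+1)) :=
      h1.div Asymptotics.IsEquivalent.refl
    refine h3.symm.tendsto_nhds ?_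
    refine tendsto_const_nhds.congr' ?_
    filter_upwards [eventually_gt_atTop 0] with n hn
    have : (n : ℝ) ≠ 0 := by positivity
    field_simp
  have h4 := h2.mul (hrL.pow m)
  rw [one_div_mul_eq_div] at h4
  refine h4.congr' ?_
  filter_upwards [eventually_gt_atTop 0] with n hn
  have : (n : ℝ) ≠ 0 := by positivity
  rw [mul_pow, ← pow_mul, pow_succ]
  field_simp

theorem statement6
    {Ω : Type} [MeasureSpace Ω] [IsProbabilityMeasure (ℙ : Measure Ω)]
    -- the common density of the points, bounded and a.e. continuous
    (f : ℂ → ℝ) (hf0 : ∀ x, 0 ≤ f x) (hfb : ∃ C, ∀ x, f x ≤ C)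
    (hfc : ∀ᵐ x : ℂ, ContinuousAt f x)
    -- the central angle α ∈ (0, 2π]
    (a : ℝ) (ha : 0 < a) (ha' : a ≤ 2 * π)
    -- `Z i = (Xᵢ, Yᵢ)`: i.i.d., `Xᵢ` with density `f`, `Yᵢ` uniform on `[0, 2π)`,
    -- the `Xᵢ` independent of the `Yᵢ`
    (Z : ℕ → Ω → ℂ × ℝ) (hZm : ∀ i, Measurable (Z i))
    (hZi : iIndepFun Z ℙ)
    (hZd : ∀ i, Measure.map (Z i) ℙ =
      (volume.withDensity fun x => ENNReal.ofReal (f x)).prod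
        ((ENNReal.ofReal (2 * π))⁻¹ • volume.restrict (Set.Ico 0 (2 * π))))
    -- `T` a feasible connected digraph of order `k`
    (k : ℕ) (hk : 1 ≤ k) (T : Fin k → Fin k → Prop) (hTirr : ∀ i, ¬ T i i)
    (hTconn : (SimpleGraph.fromRel T).Connected)
    (hTfeas : ∃ ρ : ℝ, 0 < ρ ∧
      0 < ℙ {ω | isoT a ρ T (fun i : Fin k => (Z i ω).1) (fun i : Fin k => (Z i ω).2)})
    -- the positive cutoffs
    (r : ℕ → ℝ) (hrpos : ∀ n, 0 < r n)
    (L : ℝ) (hL : 0 < L)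
    (hr : Tendsto (fun n : ℕ => (n : ℝ) * r n ^ 2) atTop (𝓝 L)) :
    Tendsto (fun n : ℕ =>
        (∫ ω, (isolatedCount a (r n) T
          (fun i : Fin n => (Z i ω).1) (fun i : Fin n => (Z i ω).2) : ℝ) ∂ℙ) / n)
      atTop (𝓝 ((k : ℝ)⁻¹ * ∫ x : ℂ, phiT a k T (L * f x) * f x)) := by
  obtain ⟨m, rfl⟩ : ∃ m, k = m + 1 := ⟨k - 1, by omega⟩
  obtain ⟨C, hC⟩ := hfb
  have hfm : AEMeasurable f := aemeas_of_continuousAt f hfc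
  have hZd' : ∀ i, Measure.map (Z i) ℙ = (muF f).prod nuU := hZd
  have hmass : muF f univ = 1 := by
    have h1 : ((muF f).prod nuU) (univ ×ˢ univ) = 1 := by
      rw [← hZd' 0, univ_prod_univ, Measure.map_apply (hZm 0) MeasurableSet.univ, preimage_univ,
        measure_univ]
    rwa [Measure.prod_prod, measure_univ (μ := nuU), mul_one] at h1
  have : IsProbabilityMeasure (muF f) := ⟨hmass⟩
  have hfi : Integrable f := by
    refine ⟨hfm.aestronglyMeasurable, ?_⟩
    rw [hasFiniteIntegral_iff_ofReal (Eventually.of_forall hf0)]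
    rw [muF, withDensity_apply _ MeasurableSet.univ, Measure.restrict_univ] at hmass
    rw [hmass]; exact ENNReal.one_lt_top
  have hr0 : Tendsto r atTop (𝓝 0) := by
    have h := hr.mul tendsto_one_div_atTop_nhds_zero_nat
    rw [mul_zero] at h
    have h2 : Tendsto (fun n => r n ^ 2) atTop (𝓝 0) := by
      refine h.congr' ?_
      filter_upwards [eventually_gt_atTop 0] with n hn
      have : (n : ℝ) ≠ 0 := by positivity
      field_simp
    have h3 := h2.sqrt
    rw [Real.sqrt_zero] at h3
    exact h3.congr fun n => Real.sqrt_sq (hrpos n).le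
  have hE : ∀ n : ℕ, (∫ ω, (isolatedCount a (r n) T
          (fun i : Fin n => (Z i ω).1) (fun i : Fin n => (Z i ω).2) : ℝ) ∂ℙ) =
        (n.choose (m+1) : ℝ) * (r n ^ (2 * m) * ∫ x, ∫ y, (∫ z, inner3 f a (r n) T n x y z)
        ∂(Measure.pi (fun _ : Fin (m+1) => nuU)) ∂(muF f)) := by
    intro n
    have hmap : Measure.map (fun ω (i : Fin n) => Z i ω) ℙ =
        Measure.pi (fun _ : Fin n => (muF f).prod nuU) := by
      have hi : iIndepFun (fun i : Fin n => Z i) ℙ := hZi.precomp Fin.val_injective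
      rw [(iIndepFun_iff_map_fun_eq_pi_map (fun i => (hZm _).aemeasurable)).1 hi]
      simp_rw [hZd']
    have hcm : Measurable fun w : Fin n → ℂ × ℝ =>
        (isolatedCount a (r n) T (fun i => (w i).1) (fun i => (w i).2) : ℝ) := by
      simp_rw [isolatedCount_eq]
      exact Finset.measurable_fun_sum _ fun s _ =>
        measurable_const.indicator (goodSet_measurable a (r n) T s)
    have h1 := integral_map (μ := (ℙ : Measure Ω)) (φ := fun ω (i : Fin n) => Z i ω)
      (measurable_pi_lambda (fun ω (i : Fin n) => Z i ω) fun i => hZm i).aemeasurable hcm.aestronglyMeasurable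
    rw [← h1, hmap, expect_count, expect_iter _ _ _ (Gfun_measurable _ _ _ _ _)
      (Gfun_nonneg _ _ _ _ _) (Gfun_le_one _ _ _ _ _)]
    simp_rw [inner_eq f hf0 hfi a (r n) (hrpos n) T n, integral_const_mul]
  have hlim := (tendsto_coeff r L m hr).mul
    (outer_tendsto f hf0 C hC hfc hfi a r hrpos hr0 L hr T hTconn)
  have hval : ((m + 1 : ℕ) : ℝ)⁻¹ * ∫ x : ℂ, phiT a (m+1) T (L * f x) * f x =
      L ^ m / (m+1).factorial * ∫ x, ∫ y, (f x ^ m * ∫ z : Fin m → ℂ,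
        hInd a T (pts (k := m+1) z) y *
        Real.exp (-(L * f x) * sectorUnionVol a (pts (k := m+1) z) y))
        ∂(Measure.pi (fun _ : Fin (m+1) => nuU)) ∂(muF f) := by
    rw [integral_muF f hf0 hfm, ← integral_const_mul, ← integral_const_mul]
    refine integral_congr_ae (Eventually.of_forall fun x => ?_)
    simp only [phiT_eq a ha ha' m T hTirr, integral_pi_nuU, integral_const_mul]
    rw [Nat.factorial_succ]
    push_cast
    have := Real.pi_pos
    have hfac : (m.factorial : ℝ) ≠ 0 := by positivity
    have hm1 : (m : ℝ) + 1 ≠ 0 := by positivity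
    rw [mul_pow L (f x) m]
    field_simp
  rw [hval]
  refine hlim.congr fun n => ?_
  rw [hE n]
  ring


end
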